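/- Let $E$ be a normed Riesz space, $M$ a positive uniformly bounded subset of $E$, and $\psi$ a linear functional on $E_M$ that is continuous for the $p_M$-norm. Then $\sup\{\psi(m) : m \in M\} \le \|\psi\|_{op}$, where $\|\psi\|_{op}$ is the operator norm of $\psi$ with respect to $p_M$; and if moreover $\psi$ is positive, then $\|\psi\|_{op} = \sup\{\psi(m) : m \in M\}$. -/

import Mathlib

open scoped BigOperators

section MajorizedDefs

variable {E : Type*} [AddCommGroup E] [PartialOrder E] [Module ℝ E]

/-- `M` is a *positive subset* of the ordered vector space `E`: it is nonempty, contained in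
the positive cone, and `0` does not belong to its convex hull. -/
def IsPositiveSubset (M : Set E) : Prop :=
  M.Nonempty ∧ (∀ m ∈ M, 0 ≤ m) ∧ (0 : E) ∉ convexHull ℝ M

/-- The proper convex cone `C_M` generated by a positive subset `M`. -/
def coneGen (M : Set E) : Set E :=
  {c | ∃ (t : ℝ) (m : E), 0 ≤ t ∧ m ∈ convexHull ℝ M ∧ m ≠ 0 ∧ c = t • m}

/-- The majorized space `E_M`: all vectors `v` with `±v ≤ c` for some `c ∈ C_M`. -/
def EMaj (M : Set E) : Set E :=
  {v | ∃ c ∈ coneGen M, -v ≤ c ∧ v ≤ c}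

/-- The majorizing seminorm `p_M`. -/
noncomputable def pM (M : Set E) (v : E) : ℝ :=
  sInf {s : ℝ | ∃ (n : ℕ) (t : Fin n → ℝ) (m : Fin n → E),
    0 < n ∧ (∀ j, 0 ≤ t j) ∧ (∀ j, m j ∈ M) ∧
    (-v ≤ ∑ j, t j • m j) ∧ (v ≤ ∑ j, t j • m j) ∧ s = ∑ j, t j}

end MajorizedDefs

section MajorizedLemmas

/-- Every element of the generated cone is a nonempty nonnegative combination of elements
of `M`. -/
lemma exists_sum_smul_eq_of_mem_coneGen {E : Type*} [AddCommGroup E] [Module ℝ E]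
    {M : Set E} {c : E} (hc : c ∈ coneGen M) :
    ∃ (n : ℕ) (t : Fin n → ℝ) (m : Fin n → E),
      0 < n ∧ (∀ j, 0 ≤ t j) ∧ (∀ j, m j ∈ M) ∧ c = ∑ j, t j • m j := by
  obtain ⟨s, a, hs, ha, -, rfl⟩ := hc
  obtain ⟨ι, _, w, z, hw, hw1, hz, rfl⟩ := mem_convexHull_iff_exists_fintype.1 ha
  have : Nonempty ι := by
    by_contra h
    rw [not_nonempty_iff] at h
    simp at hw1
  let e := (Fintype.equivFin ι).symm
  refine ⟨Fintype.card ι, fun j => s * w (e j), fun j => z (e j), Fintype.card_pos,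
    fun j => mul_nonneg hs (hw _), fun j => hz _, ?_⟩
  rw [e.sum_comp fun i => (s * w i) • z i, Finset.smul_sum]
  simp only [mul_smul]

variable {E : Type*} [AddCommGroup E] [PartialOrder E] [Module ℝ E] {M : Set E}

lemma pM_nonneg (M : Set E) (v : E) : 0 ≤ pM M v := by
  apply Real.sInf_nonneg
  rintro s ⟨n, t, m, -, ht, -, -, -, rfl⟩
  exact Finset.sum_nonneg fun j _ => ht j

lemma IsPositiveSubset.ne_zero_of_mem_convexHull (hM : IsPositiveSubset M) {m : E}
    (hm : m ∈ convexHull ℝ M) : m ≠ 0 := by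
  rintro rfl
  exact hM.2.2 hm

/-- Nonnegative combinations of elements of `M` belong to the generated cone. -/
lemma IsPositiveSubset.sum_smul_mem_coneGen (hM : IsPositiveSubset M) {n : ℕ} {t : Fin n → ℝ}
    {m : Fin n → E} (ht : ∀ j, 0 ≤ t j) (hm : ∀ j, m j ∈ M) :
    ∑ j, t j • m j ∈ coneGen M := by
  rcases (Finset.sum_nonneg fun j _ => ht j : 0 ≤ ∑ j, t j).eq_or_lt with h0 | hpos
  · obtain ⟨a, ha⟩ := hM.1
    have hz : ∀ j, t j = 0 := fun j =>
      (Finset.sum_eq_zero_iff_of_nonneg fun j _ => ht j).1 h0.symm j (Finset.mem_univ j)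
    have ha' := subset_convexHull ℝ M ha
    exact ⟨0, a, le_rfl, ha', hM.ne_zero_of_mem_convexHull ha', by simp [hz]⟩
  · have hc := Finset.univ.centerMass_mem_convexHull (fun j _ => ht j) hpos (fun j _ => hm j)
    refine ⟨∑ j, t j, _, hpos.le, hc, hM.ne_zero_of_mem_convexHull hc, ?_⟩
    rw [Finset.centerMass, smul_inv_smul₀ (ne_of_gt hpos)]

variable [IsOrderedAddMonoid E]

lemma IsPositiveSubset.mem_EMaj (hM : IsPositiveSubset M) {m : E} (hm : m ∈ M) : m ∈ EMaj M := by
  have hm' := subset_convexHull ℝ M hm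
  exact ⟨m, ⟨1, m, zero_le_one, hm', hM.ne_zero_of_mem_convexHull hm', (one_smul ℝ m).symm⟩,
    neg_le_self (hM.2.1 m hm), le_rfl⟩

lemma IsPositiveSubset.pM_le_one (hM : IsPositiveSubset M) {m : E} (hm : m ∈ M) :
    pM M m ≤ 1 := by
  refine csInf_le ⟨0, ?_⟩ ⟨1, fun _ => 1, fun _ => m, one_pos, fun _ => zero_le_one,
    fun _ => hm, ?_, ?_, ?_⟩
  · rintro s ⟨n, t, m, -, ht, -, -, -, rfl⟩
    exact Finset.sum_nonneg fun j _ => ht j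
  · simpa using neg_le_self (hM.2.1 m hm)
  · simp
  · simp

lemma sub_mem_EMaj {c v : E} (hc : c ∈ coneGen M) (hneg : -v ≤ c) (hv : v ≤ c) :
    c - v ∈ EMaj M := by
  obtain ⟨t, a, ht, ha, ha0, rfl⟩ := hc
  refine ⟨t • a + t • a, ⟨t + t, a, add_nonneg ht ht, ha, ha0, (add_smul t t a).symm⟩, ?_, ?_⟩
  · rw [neg_sub]
    calc v - t • a ≤ 0 := sub_nonpos.2 hv
      _ = -v + v := (neg_add_cancel v).symm
      _ ≤ t • a + t • a := add_le_add hneg hv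
  · rw [sub_eq_add_neg]
    gcongr

lemma abs_map_le_of_mem_coneGen {ψ : E →ₗ[ℝ] ℝ} (hψ : ∀ v ∈ EMaj M, 0 ≤ v → 0 ≤ ψ v) {c v : E}
    (hc : c ∈ coneGen M) (hneg : -v ≤ c) (hv : v ≤ c) : |ψ v| ≤ ψ c := by
  have h₁ := hψ _ (sub_mem_EMaj hc hneg hv) (sub_nonneg.2 hv)
  have h₂ := hψ _ (sub_mem_EMaj (v := -v) hc (by rwa [neg_neg]) hneg) (sub_nonneg.2 hneg)
  simp only [map_sub, map_neg] at h₁ h₂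
  exact abs_le.2 ⟨by linarith, by linarith⟩

/-- A positive functional bounded by `S` on `M` is bounded by `S * p_M` on `E_M`. -/
lemma IsPositiveSubset.abs_map_le_mul_pM (hM : IsPositiveSubset M) {ψ : E →ₗ[ℝ] ℝ}
    (hψ : ∀ v ∈ EMaj M, 0 ≤ v → 0 ≤ ψ v) {S : ℝ} (hS : ∀ m ∈ M, ψ m ≤ S) {v : E}
    (hv : v ∈ EMaj M) : |ψ v| ≤ S * pM M v := by
  have hS0 : 0 ≤ S := by
    obtain ⟨a, ha⟩ := hM.1
    exact (hψ a (hM.mem_EMaj ha) (hM.2.1 a ha)).trans (hS a ha)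
  have key : ∀ (n : ℕ) (t : Fin n → ℝ) (m : Fin n → E), (∀ j, 0 ≤ t j) → (∀ j, m j ∈ M) →
      -v ≤ ∑ j, t j • m j → v ≤ ∑ j, t j • m j → |ψ v| ≤ S * ∑ j, t j := by
    intro n t m ht hm hneg hle
    refine (abs_map_le_of_mem_coneGen hψ (hM.sum_smul_mem_coneGen ht hm) hneg hle).trans ?_
    rw [map_sum, Finset.mul_sum]
    refine Finset.sum_le_sum fun j _ => ?_
    rw [map_smul, smul_eq_mul, mul_comm S]
    exact mul_le_mul_of_nonneg_left (hS _ (hm j)) (ht j)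
  obtain ⟨c, hc, hneg, hle⟩ := hv
  obtain ⟨n, t, m, hn, ht, hm, rfl⟩ := exists_sum_smul_eq_of_mem_coneGen hc
  rcases hS0.eq_or_lt with rfl | hpos
  · simpa using key n t m ht hm hneg hle
  · rw [← div_le_iff₀' hpos]
    refine le_csInf ⟨_, n, t, m, hn, ht, hm, hneg, hle, rfl⟩ ?_
    rintro s ⟨k, u, a, -, hu, ha, hneg', hle', rfl⟩
    rw [div_le_iff₀' hpos]
    exact key k u a hu ha hneg' hle'

end MajorizedLemmas

/-- Let `E` be a normed Riesz space, `M` a positive uniformly bounded subset,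
and `ψ` a `p_M`-continuous linear functional on `E_M`. Then `sup {ψ m : m ∈ M} ≤ ‖ψ‖_op`
(the operator norm with respect to `p_M`), and if moreover `ψ` is positive then
`‖ψ‖_op = sup {ψ m : m ∈ M}`. -/
theorem opnorm_of_pM_continuous_functional
    {E : Type*} [NormedAddCommGroup E] [Lattice E] [HasSolidNorm E] [IsOrderedAddMonoid E]
    [NormedSpace ℝ E] [PosSMulStrictMono ℝ E] [PosSMulReflectLT ℝ E]
    (M : Set E) (hM : IsPositiveSubset M)
    (hbdd : ∃ C : ℝ, ∀ m ∈ M, ‖m‖ ≤ C)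
    (ψ : E →ₗ[ℝ] ℝ)
    (hcont : ∃ K : ℝ, ∀ v ∈ EMaj M, |ψ v| ≤ K * pM M v) :
    (∀ m ∈ M, ψ m ≤ sSup {r : ℝ | ∃ v ∈ EMaj M, pM M v ≤ 1 ∧ r = |ψ v|}) ∧
    ((∀ v ∈ EMaj M, 0 ≤ v → 0 ≤ ψ v) →
      sSup {r : ℝ | ∃ v ∈ EMaj M, pM M v ≤ 1 ∧ r = |ψ v|} =
        sSup ((fun m => ψ m) '' M)) := by
  obtain ⟨K, hK⟩ := hcont
  have hbound : BddAbove {r : ℝ | ∃ v ∈ EMaj M, pM M v ≤ 1 ∧ r = |ψ v|} := by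
    refine ⟨max K 0, ?_⟩
    rintro r ⟨v, hv, hv1, rfl⟩
    calc |ψ v| ≤ K * pM M v := hK v hv
      _ ≤ max K 0 * pM M v := mul_le_mul_of_nonneg_right (le_max_left _ _) (pM_nonneg M v)
      _ ≤ max K 0 := mul_le_of_le_one_right (le_max_right _ _) hv1
  have hle : ∀ m ∈ M, ψ m ≤ sSup {r : ℝ | ∃ v ∈ EMaj M, pM M v ≤ 1 ∧ r = |ψ v|} := fun m hm =>
    (le_abs_self _).trans (le_csSup hbound ⟨m, hM.mem_EMaj hm, hM.pM_le_one hm, rfl⟩)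
  refine ⟨hle, fun hψ => le_antisymm ?_ ?_⟩
  · have hS : ∀ m ∈ M, ψ m ≤ sSup ((fun m => ψ m) '' M) := fun m hm =>
      le_csSup ⟨_, Set.forall_mem_image.2 hle⟩ (Set.mem_image_of_mem _ hm)
    obtain ⟨a, ha⟩ := hM.1
    have hS0 : 0 ≤ sSup ((fun m => ψ m) '' M) :=
      (hψ a (hM.mem_EMaj ha) (hM.2.1 a ha)).trans (hS a ha)
    refine csSup_le ⟨_, a, hM.mem_EMaj ha, hM.pM_le_one ha, rfl⟩ ?_
    rintro r ⟨v, hv, hv1, rfl⟩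
    exact (hM.abs_map_le_mul_pM hψ hS hv).trans (mul_le_of_le_one_right hS0 hv1)
  · exact csSup_le (hM.1.image _) (Set.forall_mem_image.2 hle)
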